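/- arXiv:2510.06555 — 9 statements merged into one kernel-verified Lean document; each statement's English description precedes it below -/
import Mathlib

section
/- Let A be a monoid, G a group, β : G → Aut(A) a function into the multiplicative automorphisms of A, and V : G → G → A^× a function into the units of A such that for all g, h ∈ G and all a ∈ A one has β_g(β_h(a)) = V(g,h) · β_{gh}(a) · V(g,h)^{-1}. Define the unit ω(g,h,k) := V(g,h) · V(gh,k) · V(g,hk)^{-1} · (β_g(V(h,k)))^{-1}. If for all g,h,k the underlying element of ω(g,h,k) is central in A (commutes with every element of A), then for all g,h,k,l ∈ G the twisted 3-cocycle identity holds in A: ω(gh,k,l) · ω(g,h,kl) = ω(g,h,k) · ω(g,hk,l) · β_g(ω(h,k,l)). -/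
/-- In a group `U` with endomorphisms `b g` composing up to conjugation by `V g h`, a central
associator `ω` of `V` is a twisted 3-cocycle. -/
theorem twisted_cocycle_of_central_associator {U G : Type*} [Group U] [Semigroup G]
    (b : G → U →* U) (V : G → G → U) (ω : G → G → G → U)
    (hb : ∀ g h u, b g (b h u) * V g h = V g h * b (g * h) u)
    (hV : ∀ g h k, V g h * V (g * h) k = ω g h k * b g (V h k) * V g (h * k))
    (hc : ∀ g h k u, ω g h k * u = u * ω g h k) (g h k l : G) :
    ω (g * h) k l * ω g h (k * l) = ω g h k * ω g (h * k) l * b g (ω h k l) := by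
  have left : V g h * V (g * h) k * V (g * h * k) l =
      ω (g * h) k l * ω g h (k * l) *
        (b g (b h (V k l)) * b g (V h (k * l)) * V g (h * (k * l))) := by
    calc V g h * V (g * h) k * V (g * h * k) l
        = V g h * ω (g * h) k l * (b (g * h) (V k l) * V (g * h) (k * l)) := by
          simp only [mul_assoc (V g h), hV (g * h) k l, mul_assoc (ω (g * h) k l)]
      _ = ω (g * h) k l * (V g h * b (g * h) (V k l)) * V (g * h) (k * l) := by
          simp only [← hc (g * h) k l (V g h), mul_assoc]
      _ = ω (g * h) k l * b g (b h (V k l)) * (V g h * V (g * h) (k * l)) := by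
          simp only [← hb, mul_assoc]
      _ = ω (g * h) k l * (b g (b h (V k l)) * ω g h (k * l)) *
            (b g (V h (k * l)) * V g (h * (k * l))) := by
          simp only [hV, mul_assoc]
      _ = _ := by simp only [← hc g h (k * l) (b g _), mul_assoc]
  have right : V g h * V (g * h) k * V (g * h * k) l =
      ω g h k * ω g (h * k) l * b g (ω h k l) *
        (b g (b h (V k l)) * b g (V h (k * l)) * V g (h * (k * l))) := by
    calc V g h * V (g * h) k * V (g * h * k) l
        = ω g h k * b g (V h k) * (V g (h * k) * V (g * (h * k)) l) := by
          simp only [hV g h k, mul_assoc]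
      _ = ω g h k * (b g (V h k) * ω g (h * k) l) *
            (b g (V (h * k) l) * V g (h * k * l)) := by
          simp only [hV g (h * k) l, mul_assoc]
      _ = ω g h k * ω g (h * k) l * b g (V h k * V (h * k) l) * V g (h * k * l) := by
          simp only [← hc g (h * k) l (b g _), map_mul, mul_assoc]
      _ = _ := by simp only [hV h k l, map_mul, mul_assoc]
  exact mul_right_cancel (left.symm.trans right)


/-- **Twisted 3-cocycle identity for the anomaly index.**
`A` is a monoid (abstracting the quasi-local operator algebra), `G` a symmetry group,
`β g` the half-chain automorphisms, and `V g h` units implementing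
`β g ∘ β h = Ad_{V g h} ∘ β (g*h)`.  If the units
`ω g h k = V g h * V (g*h) k * (V g (h*k))⁻¹ * (β g (V h k))⁻¹` are central in `A`,
then `ω` satisfies the twisted 3-cocycle identity in `A`. -/
theorem twisted_three_cocycle_identity
    {A : Type*} [Monoid A] {G : Type*} [Group G]
    (β : G → MulAut A) (V : G → G → Aˣ)
    (hβV : ∀ g h : G, ∀ a : A,
      β g (β h a) = (V g h : A) * β (g * h) a * (((V g h)⁻¹ : Aˣ) : A))
    (ω : G → G → G → Aˣ)
    (hω : ∀ g h k : G, ω g h k =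
      V g h * V (g * h) k * (V g (h * k))⁻¹ *
        (Units.map (β g).toMonoidHom (V h k))⁻¹)
    (hcentral : ∀ g h k : G, ∀ a : A, (ω g h k : A) * a = a * (ω g h k : A)) :
    ∀ g h k l : G,
      (ω (g * h) k l : A) * (ω g h (k * l) : A) =
        (ω g h k : A) * (ω g (h * k) l : A) *
          ((Units.map (β g).toMonoidHom (ω h k l) : Aˣ) : A) := by
  intro g h k l
  have key := twisted_cocycle_of_central_associator
    (fun g => Units.map (β g).toMonoidHom) V ω
    (fun g h u => Units.ext (by simp [hβV, mul_assoc]))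
    (fun g h k => by simp [hω, mul_assoc])
    (fun g h k u => Units.ext (hcentral g h k u)) g h k l
  simpa only [Units.val_mul] using congrArg Units.val key
end

section
/- Let A be a monoid, G a group, β : G → Aut(A) a function into the multiplicative automorphisms of A, and V : G → G → A^× a function into the units of A such that for all g, h ∈ G and all a ∈ A one has β_g(β_h(a)) = V(g,h) · β_{gh}(a) · V(g,h)^{-1}, and suppose each unit ω(g,h,k) := V(g,h) · V(gh,k) · V(g,hk)^{-1} · (β_g(V(h,k)))^{-1} has central underlying element in A. Given any function U : G → A^×, define new data β'_g(a) := U(g) · β_g(a) · U(g)^{-1} (an automorphism of A) and V'(g,h) := U(g) · β_g(U(h)) · V(g,h) · U(gh)^{-1}, and define ω'(g,h,k) := V'(g,h) · V'(gh,k) · V'(g,hk)^{-1} · (β'_g(V'(h,k)))^{-1}. Then ω'(g,h,k) = ω(g,h,k) for all g,h,k ∈ G. -/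
/-- **Independence of the anomaly 3-cocycle from the choice of half-chain decomposition.**
Given half-chain data `(β, V)` with central anomaly units `ω`, conjugating the data by
arbitrary units `U g` (i.e. `β' g = Ad_{U g} ∘ β g`,
`V' g h = U g * β g (U h) * V g h * (U (g*h))⁻¹`) yields the same anomaly units:
`ω' g h k = ω g h k`. -/
theorem anomaly_cocycle_independent_of_decomposition
    {A : Type*} [Monoid A] {G : Type*} [Group G]
    (β : G → MulAut A) (V : G → G → Aˣ)
    (hβV : ∀ g h : G, ∀ a : A,
      β g (β h a) = (V g h : A) * β (g * h) a * (((V g h)⁻¹ : Aˣ) : A))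
    (ω : G → G → G → Aˣ)
    (hω : ∀ g h k : G, ω g h k =
      V g h * V (g * h) k * (V g (h * k))⁻¹ *
        (Units.map (β g).toMonoidHom (V h k))⁻¹)
    (hcentral : ∀ g h k : G, ∀ a : A, (ω g h k : A) * a = a * (ω g h k : A))
    (U : G → Aˣ)
    (β' : G → MulAut A)
    (hβ' : ∀ g : G, ∀ a : A,
      β' g a = (U g : A) * β g a * (((U g)⁻¹ : Aˣ) : A))
    (V' : G → G → Aˣ)
    (hV' : ∀ g h : G, V' g h =
      U g * Units.map (β g).toMonoidHom (U h) * V g h * (U (g * h))⁻¹)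
    (ω' : G → G → G → Aˣ)
    (hω' : ∀ g h k : G, ω' g h k =
      V' g h * V' (g * h) k * (V' g (h * k))⁻¹ *
        (Units.map (β' g).toMonoidHom (V' h k))⁻¹) :
    ∀ g h k : G, ω' g h k = ω g h k := by
  intro g h k
  have map_comp (u : Aˣ) : Units.map (β (g * h)).toMonoidHom u =
      (V g h)⁻¹ * Units.map (β g).toMonoidHom (Units.map (β h).toMonoidHom u) * V g h := by
    have conj : Units.map (β g).toMonoidHom (Units.map (β h).toMonoidHom u) =
        V g h * Units.map (β (g * h)).toMonoidHom u * (V g h)⁻¹ :=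
      Units.ext (hβV g h u)
    rw [conj]
    group
  have map_conj (u : Aˣ) : Units.map (β' g).toMonoidHom u =
      U g * Units.map (β g).toMonoidHom u * (U g)⁻¹ :=
    Units.ext (hβ' g u)
  have central (u : Aˣ) : ω g h k * u = u * ω g h k := Units.ext (hcentral g h k u)
  have conj_eq : ω' g h k =
      (U g * Units.map (β g).toMonoidHom (U h) *
        Units.map (β g).toMonoidHom (Units.map (β h).toMonoidHom (U k))) * ω g h k *
      (U g * Units.map (β g).toMonoidHom (U h) *
        Units.map (β g).toMonoidHom (Units.map (β h).toMonoidHom (U k)))⁻¹ := by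
    rw [hω', map_conj, hω]
    simp only [hV', map_comp, map_mul, map_inv, mul_assoc g h k]
    group
  rw [conj_eq, ← central, mul_inv_cancel_right]
end

section
/- Let A be a monoid, G a group, β : G → Aut(A) a function into the multiplicative automorphisms of A, and V : G → G → A^× a function into the units of A such that for all g, h ∈ G and all a ∈ A one has β_g(β_h(a)) = V(g,h) · β_{gh}(a) · V(g,h)^{-1}, and define ω(g,h,k) := V(g,h) · V(gh,k) · V(g,hk)^{-1} · (β_g(V(h,k)))^{-1}. Suppose additionally there exists W : G → A^× with β_g(a) = W(g) · a · W(g)^{-1} for all g ∈ G and a ∈ A (each β_g is inner, implemented by W(g)), define η(g,h) := V(g,h)^{-1} · W(g) · W(h) · W(gh)^{-1}, and suppose each η(g,h) has central underlying element in A. Then for all g,h,k ∈ G one has, in A, ω(g,h,k) = β_g(η(h,k)) · η(g,hk) · η(g,h)^{-1} · η(gh,k)^{-1}; that is, ω is the twisted coboundary of η. -/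
/-- In a group, let `v₁`, `v₂`, `v₃`, `v₄` implement the discrepancies of `w` up to central factors
`η₁`, `η₂`, `η₃`, `η₄`.  In the associator of the `vᵢ` the `w`-parts cancel, so that it is the
twisted coboundary of the `ηᵢ`. -/
theorem associator_eq_coboundary_of_central {H : Type*} [Group H]
    {a b c ab bc abc v₁ v₂ v₃ v₄ η₁ η₂ η₃ η₄ : H}
    (h₁ : η₁ = v₁⁻¹ * a * b * ab⁻¹) (h₂ : η₂ = v₂⁻¹ * ab * c * abc⁻¹)
    (h₃ : η₃ = v₃⁻¹ * a * bc * abc⁻¹) (h₄ : η₄ = v₄⁻¹ * b * c * bc⁻¹)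
    (c₁ : ∀ x, Commute η₁ x) (c₂ : ∀ x, Commute η₂ x)
    (c₃ : ∀ x, Commute η₃ x) (c₄ : ∀ x, Commute η₄ x) :
    v₁ * v₂ * v₃⁻¹ * (a * v₄ * a⁻¹)⁻¹ = (a * η₄ * a⁻¹) * η₃ * η₁⁻¹ * η₂⁻¹ := by
  have e₁ : v₁ = a * b * ab⁻¹ * η₁⁻¹ := by rw [h₁]; group
  have e₂ : v₂ = ab * c * abc⁻¹ * η₂⁻¹ := by rw [h₂]; group
  have e₃ : v₃ = a * bc * abc⁻¹ * η₃⁻¹ := by rw [h₃]; group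
  have e₄ : v₄ = b * c * bc⁻¹ * η₄⁻¹ := by rw [h₄]; group
  have h₁₂ : v₁ * v₂ = a * b * c * abc⁻¹ * (η₁⁻¹ * η₂⁻¹) := by
    calc v₁ * v₂ = a * b * ab⁻¹ * (η₁⁻¹ * (ab * c * abc⁻¹)) * η₂⁻¹ := by
          rw [e₁, e₂]; group
      _ = _ := by rw [(c₁ _).inv_left.eq]; group
  have h₃₄ : v₃⁻¹ * (a * v₄ * a⁻¹)⁻¹ = η₃ * (abc * c⁻¹ * b⁻¹ * a⁻¹) * η₄ := by
    calc v₃⁻¹ * (a * v₄ * a⁻¹)⁻¹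
        = η₃ * (abc * bc⁻¹) * (η₄ * (bc * c⁻¹ * b⁻¹ * a⁻¹)) := by
          rw [e₃, e₄]; group
      _ = _ := by rw [(c₄ _).eq]; group
  calc v₁ * v₂ * v₃⁻¹ * (a * v₄ * a⁻¹)⁻¹
      = v₁ * v₂ * (v₃⁻¹ * (a * v₄ * a⁻¹)⁻¹) := by group
    _ = a * b * c * abc⁻¹ * ((η₁⁻¹ * η₂⁻¹ * η₃) * (abc * c⁻¹ * b⁻¹ * a⁻¹)) * η₄ := by
        rw [h₁₂, h₃₄]; group
    _ = η₁⁻¹ * η₂⁻¹ * η₃ * η₄ := by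
        rw [(((c₁ _).inv_left.mul_left (c₂ _).inv_left).mul_left (c₃ _)).eq]; group
    _ = η₄ * η₃ * (η₁⁻¹ * η₂⁻¹) := by
        rw [((c₄ _).symm).eq, mul_assoc η₄, ((c₃ _).symm).eq]
    _ = (a * η₄ * a⁻¹) * η₃ * η₁⁻¹ * η₂⁻¹ := by
        rw [← (c₄ a).eq]; group


/-- **The anomaly 3-cocycle is a twisted coboundary when the half-chain automorphisms
are inner.**  If each `β g` is implemented by a unit `W g` (`β g a = W g * a * (W g)⁻¹`),
and the discrepancies `η g h = (V g h)⁻¹ * W g * W h * (W (g*h))⁻¹` are central, then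
`ω g h k = β g (η h k) * η g (h*k) * (η g h)⁻¹ * (η (g*h) k)⁻¹` in `A`,
i.e. the anomaly index vanishes. -/
theorem anomaly_cocycle_is_coboundary_of_inner
    {A : Type*} [Monoid A] {G : Type*} [Group G]
    (β : G → MulAut A) (V : G → G → Aˣ)
    (hβV : ∀ g h : G, ∀ a : A,
      β g (β h a) = (V g h : A) * β (g * h) a * (((V g h)⁻¹ : Aˣ) : A))
    (ω : G → G → G → Aˣ)
    (hω : ∀ g h k : G, ω g h k =
      V g h * V (g * h) k * (V g (h * k))⁻¹ *
        (Units.map (β g).toMonoidHom (V h k))⁻¹)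
    (W : G → Aˣ)
    (hW : ∀ g : G, ∀ a : A, β g a = (W g : A) * a * (((W g)⁻¹ : Aˣ) : A))
    (η : G → G → Aˣ)
    (hη : ∀ g h : G, η g h = (V g h)⁻¹ * W g * W h * (W (g * h))⁻¹)
    (hcentral : ∀ g h : G, ∀ a : A, (η g h : A) * a = a * (η g h : A)) :
    ∀ g h k : G,
      (ω g h k : A) =
        ((Units.map (β g).toMonoidHom (η h k) : Aˣ) : A) * (η g (h * k) : A) *
          (((η g h)⁻¹ : Aˣ) : A) * (((η (g * h) k)⁻¹ : Aˣ) : A) := by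
  intro g h k
  have hmap (u : Aˣ) : Units.map (β g).toMonoidHom u = W g * u * (W g)⁻¹ :=
    Units.ext (hW g u)
  have hc (g h : G) (x : Aˣ) : Commute (η g h) x := Units.ext (hcentral g h x)
  have key := associator_eq_coboundary_of_central (hη g h) (hη (g * h) k)
    (mul_assoc g h k ▸ hη g (h * k)) (hη h k) (hc g h) (hc (g * h) k) (hc g (h * k)) (hc h k)
  rw [hω, hmap, hmap, key]
  simp only [Units.val_mul]
end

section
/- Let G₀ be a group and φ₀ : G₀ → ℤ/2 a group homomorphism, and let G = G₀ × ℤ with homomorphism φ(g,n) = φ₀(g). If ω : G×G×G → Circle is a twisted 3-cocycle with respect to φ, then its slant product ω/[1] : G₀×G₀ → Circle, defined by (ω/[1])(g,g') = ω((e,1),(g,0),(g',0)) · ω((g,0),(g',0),(e,1)) · ω((g,0),(e,1),(g',0))⁻¹, is a twisted 2-cocycle with respect to φ₀: for all g,h,k ∈ G₀, (g ▷ (ω/[1])(h,k)) · (ω/[1])(g,hk) = (ω/[1])(g,h) · (ω/[1])(gh,k). -/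
/-- The action of `g : G` on the circle group determined by a homomorphism
`φ : G → ℤ/2`: trivially if `φ g = 0`, by complex conjugation (inversion) if `φ g = 1`. -/
noncomputable def circAct {G : Type*} (φ : G → ZMod 2) (g : G) (z : Circle) : Circle :=
  if φ g = 0 then z else z⁻¹

/-- `ω : G×G×G → Circle` is a twisted 3-cocycle with respect to `φ : G → ℤ/2`. -/
def IsTwisted3Cocycle {G : Type*} [Group G] (φ : G → ZMod 2)
    (ω : G → G → G → Circle) : Prop :=
  ∀ g h k l : G,
    circAct φ g (ω h k l) * ω g h k * ω g (h * k) l = ω (g * h) k l * ω g h (k * l)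

/-- The slant product `ω/[1]` of a 3-cochain on `G₀ × ℤ` (translation written
multiplicatively):
`(ω/[1])(g,g') = ω((e,1),(g,0),(g',0)) · ω((g,0),(g',0),(e,1)) · ω((g,0),(e,1),(g',0))⁻¹`. -/
noncomputable def slant {G₀ : Type*} [Group G₀]
    (ω : G₀ × Multiplicative ℤ → G₀ × Multiplicative ℤ → G₀ × Multiplicative ℤ → Circle)
    (g g' : G₀) : Circle :=
  ω (1, Multiplicative.ofAdd 1) (g, 1) (g', 1) *
    ω (g, 1) (g', 1) (1, Multiplicative.ofAdd 1) *
      (ω (g, 1) (1, Multiplicative.ofAdd 1) (g', 1))⁻¹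

theorem circAct_mul {G : Type*} (φ : G → ZMod 2) (g : G) (z w : Circle) :
    circAct φ g (z * w) = circAct φ g z * circAct φ g w := by
  unfold circAct
  split_ifs
  · rfl
  · exact mul_inv z w

theorem circAct_inv {G : Type*} (φ : G → ZMod 2) (g : G) (z : Circle) :
    circAct φ g z⁻¹ = (circAct φ g z)⁻¹ := by
  unfold circAct
  split_ifs <;> rfl

theorem circAct_of_eq_zero {G : Type*} {φ : G → ZMod 2} {g : G} (hg : φ g = 0) (z : Circle) :
    circAct φ g z = z :=
  if_pos hg

/-- **The slant product of a twisted 3-cocycle on `G₀ × ℤ` is a twisted 2-cocycle on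
`G₀`.**  Here `φ(g,n) = φ₀ g` and the twisted 2-cocycle condition is
`(g ▷ (ω/[1])(h,k)) · (ω/[1])(g,hk) = (ω/[1])(g,h) · (ω/[1])(gh,k)`. -/
theorem slant_isTwisted2Cocycle {G₀ : Type*} [Group G₀] (φ₀ : G₀ → ZMod 2)
    (hφ₀ : ∀ g h : G₀, φ₀ (g * h) = φ₀ g + φ₀ h)
    (ω : G₀ × Multiplicative ℤ → G₀ × Multiplicative ℤ → G₀ × Multiplicative ℤ → Circle)
    (hω : IsTwisted3Cocycle (fun p => φ₀ p.1) ω) :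
    ∀ g h k : G₀,
      circAct φ₀ g (slant ω h k) * slant ω g (h * k) =
        slant ω g h * slant ω (g * h) k := by
  intro g h k
  have hφ_one : φ₀ 1 = 0 := by simpa using hφ₀ 1 1
  have h₁ := hω (1, Multiplicative.ofAdd 1) (g, 1) (h, 1) (k, 1)
  have h₂ := hω (g, 1) (1, Multiplicative.ofAdd 1) (h, 1) (k, 1)
  have h₃ := hω (g, 1) (h, 1) (1, Multiplicative.ofAdd 1) (k, 1)
  have h₄ := hω (g, 1) (h, 1) (k, 1) (1, Multiplicative.ofAdd 1)
  have circAct_fst (p : G₀ × Multiplicative ℤ) (z : Circle) :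
      circAct (fun p : G₀ × Multiplicative ℤ => φ₀ p.1) p z = circAct φ₀ p.1 z := rfl
  rw [circAct_fst, circAct_of_eq_zero hφ_one] at h₁
  simp only [circAct_fst, Prod.mk_mul_mk, one_mul, mul_one] at h₁ h₂ h₃ h₄
  simp only [slant, circAct_mul, circAct_inv]
  apply_fun Additive.ofMul at h₁ h₂ h₃ h₄ ⊢
  simp only [ofMul_mul, ofMul_inv] at h₁ h₂ h₃ h₄ ⊢
  linear_combination (norm := module) h₂ + h₄ - h₃ - h₁
end

section
/- Let G₀ be a group and φ₀ : G₀ → ℤ/2 a group homomorphism, and let G = G₀ × ℤ with homomorphism φ(g,n) = φ₀(g). If η : G₀×G₀ → Circle is a twisted 2-cocycle with respect to φ₀, then the function ω : G×G×G → Circle defined by ω((g₁,n₁),(g₂,n₂),(g₃,n₃)) = η(g₁,g₂)^{n₃} (integer power in Circle) is a twisted 3-cocycle with respect to φ. -/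
/-- `η : G×G → Circle` is a twisted 2-cocycle with respect to `φ : G → ℤ/2`. -/
def IsTwisted2Cocycle {G : Type*} [Group G] (φ : G → ZMod 2)
    (η : G → G → Circle) : Prop :=
  ∀ g h k : G, circAct φ g (η h k) * η g (h * k) = η g h * η (g * h) k

/-- The action on the circle group commutes with integer powers. -/
theorem circAct_zpow {G : Type*} (φ : G → ZMod 2) (g : G) (z : Circle) (n : ℤ) :
    circAct φ g (z ^ n) = circAct φ g z ^ n := by
  unfold circAct
  split_ifs
  · rfl
  · exact (inv_zpow z n).symm

/-- **The mixed-anomaly cocycle of an on-site symmetry with translation.**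
If `η` is a twisted 2-cocycle on `G₀` with respect to `φ₀`, then
`ω((g₁,n₁),(g₂,n₂),(g₃,n₃)) = η(g₁,g₂)^{n₃}` is a twisted 3-cocycle on `G₀ × ℤ`
(translation written multiplicatively) with respect to `φ(g,n) = φ₀ g`. -/
theorem pow_two_cocycle_isTwisted3Cocycle {G₀ : Type*} [Group G₀] (φ₀ : G₀ → ZMod 2)
    (hφ₀ : ∀ g h : G₀, φ₀ (g * h) = φ₀ g + φ₀ h)
    (η : G₀ → G₀ → Circle) (hη : IsTwisted2Cocycle φ₀ η) :
    IsTwisted3Cocycle (fun p : G₀ × Multiplicative ℤ => φ₀ p.1)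
      (fun p q r => η p.1 q.1 ^ (Multiplicative.toAdd r.2)) := by
  intro g h k l
  have hact (z : Circle) :
      circAct (fun p : G₀ × Multiplicative ℤ => φ₀ p.1) g z = circAct φ₀ g.1 z := rfl
  have hpow := congrArg (· ^ Multiplicative.toAdd l.2) (hη g.1 h.1 k.1)
  simp only [mul_zpow] at hpow
  simp only [hact, circAct_zpow, Prod.fst_mul, Prod.snd_mul, toAdd_mul, zpow_add]
  rw [mul_right_comm, hpow, mul_assoc, mul_left_comm, mul_comm (η g.1 h.1 ^ _)]
end

section
/- Let G₀ be a group and φ₀ : G₀ → ℤ/2 a group homomorphism, and let G = G₀ × ℤ with homomorphism φ(g,n) = φ₀(g). If ω : G×G×G → Circle is a twisted 3-coboundary, say ω = δ̃λ for some λ : G×G → Circle, then its slant product ω/[1] is a twisted 2-coboundary on G₀: defining ν : G₀ → Circle by ν(g) = λ((g,0),(e,1)) · λ((e,1),(g,0))⁻¹, one has (ω/[1])(g,g') = (g ▷ ν(g')) · ν(g) · ν(gg')⁻¹ for all g, g' ∈ G₀. -/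
/-- The twisted coboundary `δ̃λ` of a 2-cochain `λ : G×G → Circle`. -/
noncomputable def tcob3 {G : Type*} [Group G] (φ : G → ZMod 2)
    (lam : G → G → Circle) (g h k : G) : Circle :=
  circAct φ g (lam h k) * lam g (h * k) * (lam g h)⁻¹ * (lam (g * h) k)⁻¹

/-- The 1-cochain `ν(g) = λ((g,0),(e,1)) · λ((e,1),(g,0))⁻¹` on `G₀` associated to a
2-cochain `λ` on `G₀ × ℤ`. -/
noncomputable def nuOf {G₀ : Type*} [Group G₀]
    (lam : G₀ × Multiplicative ℤ → G₀ × Multiplicative ℤ → Circle) (g : G₀) : Circle :=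
  lam (g, 1) (1, Multiplicative.ofAdd 1) * (lam (1, Multiplicative.ofAdd 1) (g, 1))⁻¹

/-- **The slant product of a twisted 3-coboundary is a twisted 2-coboundary.**
If `ω = δ̃λ` on `G₀ × ℤ` (with `φ(g,n) = φ₀ g`), then for
`ν(g) = λ((g,0),(e,1)) · λ((e,1),(g,0))⁻¹` one has
`(ω/[1])(g,g') = (g ▷ ν(g')) · ν(g) · ν(gg')⁻¹`. -/
theorem slant_of_tcob3_is_two_coboundary {G₀ : Type*} [Group G₀] (φ₀ : G₀ → ZMod 2)
    (hφ₀ : ∀ g h : G₀, φ₀ (g * h) = φ₀ g + φ₀ h)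
    (lam : G₀ × Multiplicative ℤ → G₀ × Multiplicative ℤ → Circle) :
    ∀ g g' : G₀,
      slant (tcob3 (fun p => φ₀ p.1) lam) g g' =
        circAct φ₀ g (nuOf lam g') * nuOf lam g * (nuOf lam (g * g'))⁻¹ := by
  intro g g'
  have h1 : φ₀ 1 = 0 := by simpa using hφ₀ 1 1
  by_cases hg : φ₀ g = 0 <;>
  · simp only [slant, tcob3, nuOf, circAct, h1, hg, if_true, if_false, Prod.mk_mul_mk, one_mul,
      mul_one]
    ext
    push_cast
    field_simp
end

section
/- Let G = ℤ/2 × ℤ/2 × ℤ with homomorphism φ(x,z,n) = n mod 2, and let χ : ℤ/2 → Circle be the homomorphism with χ(0) = 1, χ(1) = −1. Then the function ω : G×G×G → Circle defined by ω((x₁,z₁,n₁),(x₂,z₂,n₂),(x₃,z₃,n₃)) = χ((x₁·z₂ + n̄₁·n̄₂)·n̄₃), where n̄ denotes the reduction of n ∈ ℤ modulo 2, is a twisted 3-cocycle with respect to φ. -/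
/-- The element `-1` of the circle group. -/
noncomputable def negOne : Circle := ⟨-1, by simp [Submonoid.unitSphere]⟩

/-- The homomorphism `χ : ℤ/2 → Circle` with `χ 0 = 1` and `χ 1 = -1`. -/
noncomputable def chi (t : ZMod 2) : Circle := if t = 0 then 1 else negOne

/-- The group `G = ℤ/2 × ℤ/2 × ℤ` (written multiplicatively). -/
abbrev GXZT : Type := Multiplicative (ZMod 2 × ZMod 2 × ℤ)

/-- The homomorphism `φ(x,z,n) = n mod 2` on `ℤ/2 × ℤ/2 × ℤ`. -/
def phiXZT (g : GXZT) : ZMod 2 := (((Multiplicative.toAdd g).2.2 : ℤ) : ZMod 2)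

/-- The anomaly 3-cocycle `ω((x₁,z₁,n₁),(x₂,z₂,n₂),(x₃,z₃,n₃)) = (-1)^{(x₁z₂+n̄₁n̄₂)n̄₃}`
of the chiral spin chain with anti-unitary translation symmetry. -/
noncomputable def omegaXZT (g₁ g₂ g₃ : GXZT) : Circle :=
  chi (((Multiplicative.toAdd g₁).1 * (Multiplicative.toAdd g₂).2.1 +
        (((Multiplicative.toAdd g₁).2.2 : ℤ) : ZMod 2) *
          (((Multiplicative.toAdd g₂).2.2 : ℤ) : ZMod 2)) *
      (((Multiplicative.toAdd g₃).2.2 : ℤ) : ZMod 2))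

theorem negOne_mul_negOne : negOne * negOne = 1 := by
  have h : (negOne : ℂ) = -1 := rfl
  ext
  simp [h]

theorem chi_add (s t : ZMod 2) : chi (s + t) = chi s * chi t := by
  have h : ∀ a : ZMod 2, a = 0 ∨ a = 1 := by decide
  have h11 : (1 + 1 : ZMod 2) = 0 := by decide
  rcases h s with rfl | rfl <;> rcases h t with rfl | rfl <;>
    simp [chi, negOne_mul_negOne, h11]

theorem chi_inv (t : ZMod 2) : (chi t)⁻¹ = chi t := by
  rw [inv_eq_iff_mul_eq_one, ← chi_add, CharTwo.add_self_eq_zero]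
  simp [chi]

theorem circAct_chi {G : Type*} (φ : G → ZMod 2) (g : G) (t : ZMod 2) :
    circAct φ g (chi t) = chi t := by
  simp [circAct, chi_inv]

/-- **The anomaly index `(-1)^{(x₁z₂+n₁n₂)n₃}` of the chiral spin chain with
anti-unitary translation is a twisted 3-cocycle** with respect to `φ(x,z,n) = n mod 2`. -/
theorem omegaXZT_isTwisted3Cocycle : IsTwisted3Cocycle phiXZT omegaXZT := by
  intro g h k l
  simp only [omegaXZT, circAct_chi, ← chi_add, toAdd_mul, Prod.fst_add, Prod.snd_add,
    Int.cast_add]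
  congr 1
  ring
end

section
/- Let G = ℤ/2 × ℤ/2 × ℤ with homomorphism φ(x,z,n) = n mod 2, and set X = (1,0,0), Z = (0,1,0), T₂ = (0,0,1), XZ = (1,1,0), e = (0,0,0). For Ω : G×G×G → Circle, define I[Ω] = Ω(T₂,X,Z)·Ω(X,Z,T₂)·Ω(X,T₂,Z)⁻¹ · Ω(Z,T₂,X)·Ω(T₂,Z,X)⁻¹·Ω(Z,X,T₂)⁻¹ · Ω(X,XZ,X)·Ω(X,X,Z)·Ω(Z,X,X)·Ω(Z,e,Z). Then I is invariant under twisted coboundary transformations: for every twisted 3-cocycle Ω : G×G×G → Circle and every λ : G×G → Circle, I[Ω · δ̃λ] = I[Ω], where Ω · δ̃λ denotes the pointwise product. -/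
/-- `X = (1,0,0)`. -/
def elX : GXZT := Multiplicative.ofAdd ((1 : ZMod 2), (0 : ZMod 2), (0 : ℤ))
/-- `Z = (0,1,0)`. -/
def elZ : GXZT := Multiplicative.ofAdd ((0 : ZMod 2), (1 : ZMod 2), (0 : ℤ))
/-- `T₂ = (0,0,1)`. -/
def elT₂ : GXZT := Multiplicative.ofAdd ((0 : ZMod 2), (0 : ZMod 2), (1 : ℤ))
/-- `XZ = (1,1,0)`. -/
def elXZ : GXZT := Multiplicative.ofAdd ((1 : ZMod 2), (1 : ZMod 2), (0 : ℤ))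
/-- `e = (0,0,0)`. -/
def elE : GXZT := Multiplicative.ofAdd ((0 : ZMod 2), (0 : ZMod 2), (0 : ℤ))

/-- The topological invariant
`I[Ω] = Ω(T₂,X,Z)·Ω(X,Z,T₂)·Ω(X,T₂,Z)⁻¹ · Ω(Z,T₂,X)·Ω(T₂,Z,X)⁻¹·Ω(Z,X,T₂)⁻¹ ·
Ω(X,XZ,X)·Ω(X,X,Z)·Ω(Z,X,X)·Ω(Z,e,Z)`. -/
noncomputable def topInv (Ω : GXZT → GXZT → GXZT → Circle) : Circle :=
  Ω elT₂ elX elZ * Ω elX elZ elT₂ * (Ω elX elT₂ elZ)⁻¹ *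
    (Ω elZ elT₂ elX * (Ω elT₂ elZ elX)⁻¹ * (Ω elZ elX elT₂)⁻¹) *
      (Ω elX elXZ elX * Ω elX elX elZ * Ω elZ elX elX * Ω elZ elE elZ)

theorem phiXZT_generators :
    phiXZT elX = 0 ∧ phiXZT elZ = 0 ∧ phiXZT elT₂ ≠ 0 := by
  simp [phiXZT, elX, elZ, elT₂]

theorem elX_mul_elZ : elX * elZ = elXZ := by decide

theorem elX_mul_elX : elX * elX = elE := by decide

theorem elX_mul_elXZ : elX * elXZ = elZ := by decide

theorem elXZ_mul_elX : elXZ * elX = elZ := by decide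

theorem elZ_mul_elE : elZ * elE = elZ := by decide

theorem elE_mul_elZ : elE * elZ = elZ := by decide

/-- `I` is multiplicative with respect to the pointwise product. -/
theorem topInv_mul (Ω Ω' : GXZT → GXZT → GXZT → Circle) :
    topInv (fun g h k => Ω g h k * Ω' g h k) = topInv Ω * topInv Ω' := by
  simp only [topInv, mul_inv]
  ac_rfl

/-- `I` is trivial on twisted coboundaries. -/
theorem topInv_tcob3 (lam : GXZT → GXZT → Circle) :
    topInv (tcob3 phiXZT lam) = 1 := by
  obtain ⟨hX, hZ, hT⟩ := phiXZT_generators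
  simp only [topInv, tcob3, circAct, hX, hZ, hT, if_true, if_false,
    mul_comm elT₂, mul_comm elZ elX, elX_mul_elZ, elX_mul_elX, elX_mul_elXZ, elXZ_mul_elX,
    elZ_mul_elE, elE_mul_elZ]
  apply Circle.ext
  simp only [Circle.coe_mul, Circle.coe_inv, Circle.coe_one]
  field_simp

/-- **`I` is invariant under twisted coboundary transformations:** for every twisted
3-cocycle `Ω` on `ℤ/2 × ℤ/2 × ℤ` (w.r.t. `φ(x,z,n) = n mod 2`) and every
`λ : G×G → Circle`, `I[Ω · δ̃λ] = I[Ω]`. -/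
theorem topInv_invariant_under_coboundary
    (Ω : GXZT → GXZT → GXZT → Circle) (hΩ : IsTwisted3Cocycle phiXZT Ω)
    (lam : GXZT → GXZT → Circle) :
    topInv (fun g h k => Ω g h k * tcob3 phiXZT lam g h k) = topInv Ω := by
  rw [topInv_mul Ω (tcob3 phiXZT lam), topInv_tcob3, mul_one]
end

section
/- Let G = ℤ/2 × ℤ/2 × ℤ with homomorphism φ(x,z,n) = n mod 2, let χ : ℤ/2 → Circle be the homomorphism with χ(0) = 1, χ(1) = −1, and let ω : G×G×G → Circle be defined by ω((x₁,z₁,n₁),(x₂,z₂,n₂),(x₃,z₃,n₃)) = χ((x₁·z₂ + n̄₁·n̄₂)·n̄₃) (n̄ = n mod 2). Then ω is not a twisted 3-coboundary: there is no function λ : G×G → Circle such that ω(g,h,k) = (g ▷ λ(h,k)) · λ(g,hk) · λ(g,h)⁻¹ · λ(gh,k)⁻¹ for all g,h,k ∈ G. -/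
/-- An invariant of twisted 3-cochains that is trivial on coboundaries. For `x`, `z` acting
trivially and `t` acting by inversion, antisymmetrizing the slant product by `t` of the coboundary
of `lam` gives `(lam z x / lam x z) ^ 2`; the remaining factors cancel this when `x * x = 1`. -/
theorem tcob3_invariant_eq_one {G : Type*} [CommGroup G] (φ : G → ZMod 2)
    (lam : G → G → Circle) {x z t : G} (hx : φ x = 0) (hz : φ z = 0) (ht : φ t = 1)
    (hxx : x * x = 1) :
    (tcob3 φ lam x z t * (tcob3 φ lam x t z)⁻¹ * tcob3 φ lam t x z) *
      (tcob3 φ lam z x t * (tcob3 φ lam z t x)⁻¹ * tcob3 φ lam t z x)⁻¹ *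
      (tcob3 φ lam x x z * (tcob3 φ lam x z x)⁻¹ * tcob3 φ lam z x x) *
      tcob3 φ lam z 1 z = 1 := by
  simp only [tcob3, circAct, hx, hz, ht, hxx, if_true, one_ne_zero, if_false, one_mul, mul_one,
    mul_comm z x, mul_comm t x, mul_comm t z]
  apply Additive.ofMul.injective
  simp only [ofMul_mul, ofMul_inv, ofMul_one]
  abel

theorem chi_one_ne_one : chi 1 ≠ 1 := by
  intro h
  rw [chi, if_neg one_ne_zero] at h
  have h' : (-1 : ℂ) = 1 := congrArg (Subtype.val : Circle → ℂ) h
  norm_num at h'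

/-- **The anomaly cocycle `ω = (-1)^{(x₁z₂+n₁n₂)n₃}` of the half-integer-spin chiral
spin chain is not a twisted 3-coboundary:** it represents a nontrivial class in
`H³_φ(ℤ₂ˣ × ℤ₂ᶻ × ℤᵀ; U(1))`. -/
theorem omegaXZT_not_coboundary :
    ¬ ∃ lam : GXZT → GXZT → Circle,
        ∀ g h k : GXZT, omegaXZT g h k = tcob3 phiXZT lam g h k := by
  rintro ⟨lam, h⟩
  have key := tcob3_invariant_eq_one phiXZT lam
    (x := .ofAdd (1, 0, 0)) (z := .ofAdd (0, 1, 0)) (t := .ofAdd (0, 0, 1))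
    (by simp [phiXZT]) (by simp [phiXZT]) (by simp [phiXZT]) (by decide)
  simp only [← h] at key
  have chi_zero : chi 0 = 1 := if_pos rfl
  simp [omegaXZT, chi_zero, chi_one_ne_one] at key
end
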